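/- arXiv:1409.8491 — 2 statements merged into one kernel-verified Lean document; each statement's English description precedes it below -/
import Mathlib

section
/- Let a > 0, let b : ℝ → ℝ be twice differentiable, let Θ ⊆ ℝ be a closed interval on which b''(t) ≥ 𝓛 > 0, and let θ ∈ Θⁿ. Let C ⊆ Θⁿ (viewed as a subset of ℝⁿ) be convex, and suppose θ* ∈ C minimizes the function ζ ↦ KL(θ, ζ) over C. Then for every ζ ∈ C, KL(θ, ζ) − KL(θ, θ*) ≥ (𝓛/(2a))‖ζ − θ*‖². -/
open Real Finset

/-- Kullback–Leibler divergence between natural-parameter vectors for a natural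
exponential family with log-partition function `b` and scale `a`. -/
noncomputable def KL (a : ℝ) (b : ℝ → ℝ) {n : ℕ} (θ ζ : Fin n → ℝ) : ℝ :=
  (1 / a) * ∑ i, (deriv b (θ i) * (θ i - ζ i) - b (θ i) + b (ζ i))

/-- A twice differentiable function whose second derivative is at least `m` on a convex set is
`m`-strongly convex there. -/
theorem strongConvexOn_of_le_deriv2 {D : Set ℝ} (hD : Convex ℝ D) {m : ℝ} {b : ℝ → ℝ}
    (hb : Differentiable ℝ b) (hb' : Differentiable ℝ (deriv b))
    (hm : ∀ t ∈ D, m ≤ deriv (deriv b) t) : StrongConvexOn D m b := by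
  rw [strongConvexOn_iff_convex]
  have h₁ (x : ℝ) : HasDerivAt (fun x ↦ b x - m / 2 * ‖x‖ ^ 2) (deriv b x - m * x) x := by
    simp only [Real.norm_eq_abs, sq_abs]
    exact ((hb x).hasDerivAt.sub ((hasDerivAt_pow 2 x).const_mul (m / 2))).congr_deriv
      (by norm_num; ring)
  have h₂ (x : ℝ) : HasDerivAt (fun x ↦ deriv b x - m * x) (deriv (deriv b) x - m) x :=
    ((hb' x).hasDerivAt.sub ((hasDerivAt_id x).const_mul m)).congr_deriv (by simp)
  exact convexOn_of_hasDerivWithinAt2_nonneg hD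
    (fun x _ ↦ (h₁ x).continuousAt.continuousWithinAt) (fun x _ ↦ (h₁ x).hasDerivWithinAt)
    (fun x _ ↦ (h₂ x).hasDerivWithinAt)
    (fun x hx ↦ sub_nonneg.2 (hm x (interior_subset hx)))

/-- Strong convexity of the Kullback–Leibler divergence in its second argument. -/
theorem KL_combo_le {n : ℕ} {a m : ℝ} (ha : 0 < a) {b : ℝ → ℝ} {D : Set ℝ}
    (hb : StrongConvexOn D m b) (θ : Fin n → ℝ) {x y : Fin n → ℝ}
    (hx : ∀ i, x i ∈ D) (hy : ∀ i, y i ∈ D) {r s : ℝ} (hr : 0 ≤ r) (hs : 0 ≤ s)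
    (hrs : r + s = 1) :
    KL a b θ (r • x + s • y) ≤
      r * KL a b θ x + s * KL a b θ y - r * s * (m / (2 * a) * ∑ i, (x i - y i) ^ 2) := by
  have key : ∑ i, (deriv b (θ i) * (θ i - (r • x + s • y) i) - b (θ i) + b ((r • x + s • y) i)) ≤
      ∑ i, (r * (deriv b (θ i) * (θ i - x i) - b (θ i) + b (x i)) +
        s * (deriv b (θ i) * (θ i - y i) - b (θ i) + b (y i)) -
        r * s * (m / 2 * (x i - y i) ^ 2)) := by
    refine Finset.sum_le_sum fun i _ ↦ ?_
    have h := hb.2 (hx i) (hy i) hr hs hrs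
    simp only [smul_eq_mul, Real.norm_eq_abs, sq_abs] at h
    simp only [Pi.add_apply, Pi.smul_apply, smul_eq_mul]
    obtain rfl : r = 1 - s := by linarith
    linarith
  simp only [Finset.sum_sub_distrib, Finset.sum_add_distrib, ← Finset.mul_sum] at key
  simp only [KL, Finset.sum_sub_distrib, Finset.sum_add_distrib]
  refine (mul_le_mul_of_nonneg_left key (one_div_pos.2 ha).le).trans_eq ?_
  field_simp

/-- Strong convexity of the Kullback–Leibler divergence: if `θ*` minimizes
`ζ ↦ KL(θ,ζ)` over a convex set `C ⊆ Θⁿ`, then for every `ζ ∈ C`,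
`KL(θ,ζ) − KL(θ,θ*) ≥ (𝓛/(2a))‖ζ − θ*‖²`. -/
theorem kl_strong_convexity_of_min {n : ℕ} (a 𝓛 : ℝ) (ha : 0 < a) (h𝓛 : 0 < 𝓛)
    (b : ℝ → ℝ) (hb : Differentiable ℝ b) (hb' : Differentiable ℝ (deriv b))
    (Θ : Set ℝ) (hΘclosed : IsClosed Θ) (hΘinterval : Θ.OrdConnected)
    (hL : ∀ t ∈ Θ, 𝓛 ≤ deriv (deriv b) t)
    (θ : Fin n → ℝ) (hθ : ∀ i, θ i ∈ Θ)
    (C : Set (Fin n → ℝ)) (hC : Convex ℝ C) (hCΘ : ∀ ζ ∈ C, ∀ i, ζ i ∈ Θ)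
    (θstar : Fin n → ℝ) (hθstar : θstar ∈ C)
    (hmin : ∀ ζ ∈ C, KL a b θ θstar ≤ KL a b θ ζ) :
    ∀ ζ ∈ C, 𝓛 / (2 * a) * ∑ i, (ζ i - θstar i) ^ 2 ≤ KL a b θ ζ - KL a b θ θstar := by
  intro ζ hζ
  have hconv := strongConvexOn_of_le_deriv2 hΘinterval.convex hb hb' hL
  set X := 𝓛 / (2 * a) * ∑ i, (ζ i - θstar i) ^ 2 with hX
  have hstep (s : ℝ) (hs : 0 < s) (hs1 : s < 1) :
      (1 - s) * X ≤ KL a b θ ζ - KL a b θ θstar := by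
    have h := (hmin _ (hC hζ hθstar hs.le (sub_nonneg.2 hs1.le) (by ring))).trans
      (KL_combo_le ha hconv θ (hCΘ ζ hζ) (hCΘ θstar hθstar) hs.le (sub_nonneg.2 hs1.le) (by ring))
    rw [← hX] at h
    refine le_of_mul_le_mul_left ?_ hs
    linarith
  by_contra! hlt
  have hY : 0 ≤ KL a b θ ζ - KL a b θ θstar := sub_nonneg.2 (hmin ζ hζ)
  set Y := KL a b θ ζ - KL a b θ θstar
  have hX0 : 0 < X := hY.trans_lt hlt
  have h := hstep ((X - Y) / (2 * X)) (div_pos (by linarith) (by linarith))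
    ((div_lt_one (by linarith)).2 (by linarith))
  have he : (1 - (X - Y) / (2 * X)) * X = (X + Y) / 2 := by
    field_simp
    ring
  linarith
end

section
/- Let c > 1 be a real number and let 1 ≤ r ≤ p be integers. Then Σ_{k=1}^{r−1} C(p,k) exp(−k c ln(pe/k)) + exp(−r c) ≤ 1 + e^{−(c−1)} / (1 − e^{−(c−1)}). In particular, the weights L_k = c ln(pe/k) for k = 1, …, r−1 and L_r = c satisfy Σ_{k=1}^{r−1} C(p,k) e^{−k L_k} + e^{−r L_r} ≤ S(c) for a constant S(c) depending only on c. -/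
open Real Finset

theorem Nat.cast_choose_le_mul_exp_one_div_pow {k : ℕ} (hk : 0 < k) (p : ℕ) :
    (p.choose k : ℝ) ≤ ((p : ℝ) * Real.exp 1 / (k : ℝ)) ^ k := by
  have hk' : (0 : ℝ) < k := by exact_mod_cast hk
  have hfac : (0 : ℝ) < (k.factorial : ℝ) := by exact_mod_cast k.factorial_pos
  have h : (k : ℝ) ^ k / (k.factorial : ℝ) ≤ Real.exp 1 ^ k := by
    simpa [← Real.exp_nat_mul] using Real.pow_div_factorial_le_exp (k : ℝ) hk'.le k
  calc (p.choose k : ℝ) ≤ (p : ℝ) ^ k / (k.factorial : ℝ) := Nat.choose_le_pow_div k p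
    _ = (p : ℝ) ^ k * ((k : ℝ) ^ k / (k.factorial : ℝ)) / (k : ℝ) ^ k := by field_simp
    _ ≤ (p : ℝ) ^ k * Real.exp 1 ^ k / (k : ℝ) ^ k := by gcongr
    _ = ((p : ℝ) * Real.exp 1 / (k : ℝ)) ^ k := by rw [div_pow, mul_pow]

theorem Real.one_le_log_mul_exp_one_div {x y : ℝ} (hx : 0 < x) (hxy : x ≤ y) :
    1 ≤ Real.log (y * Real.exp 1 / x) := by
  have hy : 0 < y := hx.trans_le hxy
  rw [Real.le_log_iff_exp_le (by positivity), le_div_iff₀ hx, mul_comm]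
  gcongr

theorem Nat.cast_choose_mul_exp_neg_log_le {c : ℝ} (hc : 1 ≤ c) {k p : ℕ} (hk : 0 < k)
    (hkp : k ≤ p) :
    (p.choose k : ℝ) *
        Real.exp (-(k : ℝ) * (c * Real.log ((p : ℝ) * Real.exp 1 / (k : ℝ)))) ≤
      Real.exp (-(c - 1)) ^ k := by
  have hk' : (0 : ℝ) < k := by exact_mod_cast hk
  have hp : (0 : ℝ) < p := by exact_mod_cast hk.trans_le hkp
  have hlog := Real.one_le_log_mul_exp_one_div hk' (Nat.cast_le.mpr hkp)
  have hchoose := Nat.cast_choose_le_mul_exp_one_div_pow hk p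
  have hpos : 0 < (p : ℝ) * Real.exp 1 / (k : ℝ) := by positivity
  rw [← Real.exp_log hpos, ← Real.exp_nat_mul] at hchoose
  generalize Real.log ((p : ℝ) * Real.exp 1 / (k : ℝ)) = L at hlog hchoose ⊢
  calc (p.choose k : ℝ) * Real.exp (-(k : ℝ) * (c * L))
      ≤ Real.exp (k * L) * Real.exp (-(k : ℝ) * (c * L)) := by gcongr
    _ = Real.exp (-(k * ((c - 1) * L))) := by rw [← Real.exp_add]; ring_nf
    _ ≤ Real.exp (-(k * ((c - 1) * 1))) := by
        have : 0 ≤ c - 1 := sub_nonneg.mpr hc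
        gcongr
    _ = Real.exp (-(c - 1)) ^ k := by rw [← Real.exp_nat_mul]; ring_nf

/-- For the variable weights `L_k = c ln(pe/k)` (`k = 1,…,r−1`) and `L_r = c`, with `c > 1`
and `1 ≤ r ≤ p`, one has
`Σ_{k=1}^{r−1} C(p,k) e^{−k c ln(pe/k)} + e^{−rc} ≤ 1 + e^{−(c−1)}/(1 − e^{−(c−1)})`. -/
theorem sum_choose_exp_variable_weights (c : ℝ) (hc : 1 < c) (r p : ℕ)
    (hr : 1 ≤ r) (hrp : r ≤ p) :
    (∑ k ∈ Finset.Ico 1 r, (p.choose k : ℝ) *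
        Real.exp (-(k : ℝ) * (c * Real.log ((p : ℝ) * Real.exp 1 / (k : ℝ)))))
        + Real.exp (-(r : ℝ) * c)
      ≤ 1 + Real.exp (-(c - 1)) / (1 - Real.exp (-(c - 1))) := by
  have hq : Real.exp (-(c - 1)) < 1 := Real.exp_lt_one_iff.mpr (by linarith)
  have hsum := (Finset.sum_le_sum fun k hk ↦ Nat.cast_choose_mul_exp_neg_log_le hc.le
    (Finset.mem_Ico.mp hk).1 ((Finset.mem_Ico.mp hk).2.le.trans hrp)).trans
      (geom_sum_Ico_le_of_lt_one (m := 1) (n := r) (Real.exp_nonneg (-(c - 1))) hq)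
  have hlast : Real.exp (-(r : ℝ) * c) ≤ 1 :=
    Real.exp_le_one_iff.mpr (mul_nonpos_of_nonpos_of_nonneg (by simp) (by linarith))
  rw [pow_one] at hsum
  linarith
end
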